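/- Fix an integer q ≥ 5. Let â_n, b̂_n be the sums of the values of the type-A and type-B vertices of row n of the hyperbolic Pascal triangle {4,q}, and let ŝ_n = â_n + b̂_n + 2 be the sum of all values of row n. Then each of the three sequences {â_n}, {b̂_n}, {ŝ_n} satisfies the ternary homogeneous recurrence x_n = q·x_{n−1} − (q+1)·x_{n−2} + 2·x_{n−3} for all n ≥ 4, and the initial values are â_1 = 0, â_2 = 2, â_3 = 6; b̂_1 = 0, b̂_2 = 0, b̂_3 = 2(q−4); ŝ_1 = 2, ŝ_2 = 4, ŝ_3 = 2q. -/

import Mathlib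

/-- Type of a vertex in a hyperbolic Pascal triangle: winger, A, or B. -/
inductive HVType where
  | W : HVType
  | A : HVType
  | B : HVType
deriving DecidableEq, Repr

/-- Number of type-B children produced by a vertex of the given type
in the hyperbolic Pascal triangle `{4,q}`. -/
def hBCount (q : ℕ) : HVType → ℕ
  | .A => q - 4
  | .B => q - 3
  | .W => 0

/-- The inner part of the next row: for each pair of consecutive vertices a shared
type-A child whose value is the sum of the parents' values, followed by the
type-B copies of the right parent. -/
def hMid (q : ℕ) : List (HVType × ℕ) → List (HVType × ℕ)
  | a :: b :: rest =>
      (HVType.A, a.2 + b.2) ::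
        (List.replicate (hBCount q b.1) (HVType.B, b.2) ++ hMid q (b :: rest))
  | _ => []

/-- Row `n` of the hyperbolic Pascal triangle `{4,q}`, as a list of
(type, value) pairs read from left to right. -/
def hRow (q : ℕ) : ℕ → List (HVType × ℕ)
  | 0 => [(HVType.W, 1)]
  | n + 1 => (HVType.W, 1) :: (hMid q (hRow q n) ++ [(HVType.W, 1)])

/-- Number of type-A vertices of row `n`. -/
def hCountA (q n : ℕ) : ℕ := ((hRow q n).filter (fun v => v.1 = HVType.A)).length

/-- Number of type-B vertices of row `n`. -/
def hCountB (q n : ℕ) : ℕ := ((hRow q n).filter (fun v => v.1 = HVType.B)).length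

/-- Sum of the values of the type-A vertices of row `n`. -/
def hSumA (q n : ℕ) : ℕ :=
  (((hRow q n).filter (fun v => v.1 = HVType.A)).map Prod.snd).sum

/-- Sum of the values of the type-B vertices of row `n`. -/
def hSumB (q n : ℕ) : ℕ :=
  (((hRow q n).filter (fun v => v.1 = HVType.B)).map Prod.snd).sum

/-- The number `s_n` of vertices of row `n`. -/
def hLen (q n : ℕ) : ℕ := (hRow q n).length

/-- The value of the `k`-th (0-indexed) vertex of row `n`. -/
def hVal (q n k : ℕ) : ℕ := ((hRow q n).getD k (HVType.W, 0)).2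

/-- The type of the `k`-th (0-indexed) vertex of row `n`. -/
def hType (q n k : ℕ) : HVType := ((hRow q n).getD k (HVType.W, 0)).1

/-- Sum of the values of the vertices of type `t` in a list of vertices. -/
def typeSum (t : HVType) (l : List (HVType × ℕ)) : ℕ :=
  ((l.filter (fun v => v.1 = t)).map Prod.snd).sum

@[simp] theorem typeSum_nil (t : HVType) : typeSum t [] = 0 := rfl

@[simp] theorem typeSum_cons (t : HVType) (v : HVType × ℕ) (l : List (HVType × ℕ)) :
    typeSum t (v :: l) = (if v.1 = t then v.2 else 0) + typeSum t l := by
  by_cases h : v.1 = t <;> simp [typeSum, h]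

@[simp] theorem typeSum_append (t : HVType) (l₁ l₂ : List (HVType × ℕ)) :
    typeSum t (l₁ ++ l₂) = typeSum t l₁ + typeSum t l₂ := by
  simp [typeSum]

@[simp] theorem typeSum_replicate (t : HVType) (k : ℕ) (v : HVType × ℕ) :
    typeSum t (List.replicate k v) = if v.1 = t then k * v.2 else 0 := by
  by_cases h : v.1 = t <;> simp [typeSum, h]

theorem sum_hMid (q : ℕ) (l : List (HVType × ℕ)) :
    ((hMid q l).map Prod.snd).sum = typeSum .A (hMid q l) + typeSum .B (hMid q l) := by
  induction l with
  | nil => simp [hMid]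
  | cons a l ih =>
    cases l with
    | nil => simp [hMid]
    | cons b l => simp [hMid, ih]; ring

theorem typeSum_A_hMid (q : ℕ) (a b : HVType × ℕ) (l : List (HVType × ℕ)) :
    typeSum .A (hMid q (a :: (l ++ [b]))) = a.2 + 2 * (l.map Prod.snd).sum + b.2 := by
  induction l generalizing a with
  | nil => simp [hMid]
  | cons c l ih =>
    have h := ih c
    simp [hMid, h]; ring

theorem typeSum_B_hMid (q w : ℕ) (a : HVType × ℕ) (l : List (HVType × ℕ)) :
    typeSum .B (hMid q (a :: (l ++ [(.W, w)]))) =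
      (q - 4) * typeSum .A l + (q - 3) * typeSum .B l := by
  induction l generalizing a with
  | nil => simp [hMid, hBCount]
  | cons c l ih =>
    have h := ih c
    obtain ⟨_ | _ | _, v⟩ := c <;> simp [hMid, hBCount, h] <;> ring

theorem hSumA_succ_eq_hMid (q n : ℕ) : hSumA q (n + 1) = typeSum .A (hMid q (hRow q n)) := by
  change typeSum .A (hRow q (n + 1)) = _
  simp [hRow]

theorem hSumB_succ_eq_hMid (q n : ℕ) : hSumB q (n + 1) = typeSum .B (hMid q (hRow q n)) := by
  change typeSum .B (hRow q (n + 1)) = _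
  simp [hRow]

theorem sum_hRow_succ (q n : ℕ) :
    ((hRow q (n + 1)).map Prod.snd).sum = hSumA q (n + 1) + hSumB q (n + 1) + 2 := by
  rw [hSumA_succ_eq_hMid, hSumB_succ_eq_hMid, ← sum_hMid]
  simp [hRow]; ring

theorem hSumA_one (q : ℕ) : hSumA q 1 = 0 := by
  simp [hSumA_succ_eq_hMid, hRow, hMid]

theorem hSumB_one (q : ℕ) : hSumB q 1 = 0 := by
  simp [hSumB_succ_eq_hMid, hRow, hMid]

theorem hSumA_add_two (q n : ℕ) :
    hSumA q (n + 2) = 2 * hSumA q (n + 1) + 2 * hSumB q (n + 1) + 2 := by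
  rw [hSumA_succ_eq_hMid q (n + 1), hRow, typeSum_A_hMid, sum_hMid, hSumA_succ_eq_hMid,
    hSumB_succ_eq_hMid]
  ring

theorem hSumB_add_two (q n : ℕ) :
    hSumB q (n + 2) = (q - 4) * hSumA q (n + 1) + (q - 3) * hSumB q (n + 1) := by
  rw [hSumB_succ_eq_hMid q (n + 1), hRow, typeSum_B_hMid, hSumA_succ_eq_hMid,
    hSumB_succ_eq_hMid]

/-- For `q ≥ 5`, the sums `â_n`, `b̂_n` of the values of the type-A and
type-B vertices and the total sum `ŝ_n = â_n + b̂_n + 2` of the values of row `n` of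
the hyperbolic Pascal triangle `{4,q}` all satisfy
`x_n = q·x_{n-1} - (q+1)·x_{n-2} + 2·x_{n-3}` for `n ≥ 4`, with the stated
initial values. -/
theorem stmt_4 (q : ℕ) (hq : 5 ≤ q) :
    (∀ n, 1 ≤ n →
      (((hRow q n).map Prod.snd).sum : ℕ) = hSumA q n + hSumB q n + 2) ∧
    (∀ n, 4 ≤ n →
      (hSumA q n : ℤ) = (q : ℤ) * hSumA q (n - 1)
          - ((q : ℤ) + 1) * hSumA q (n - 2) + 2 * hSumA q (n - 3) ∧
      (hSumB q n : ℤ) = (q : ℤ) * hSumB q (n - 1)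
          - ((q : ℤ) + 1) * hSumB q (n - 2) + 2 * hSumB q (n - 3) ∧
      ((((hRow q n).map Prod.snd).sum : ℤ))
        = (q : ℤ) * (((hRow q (n - 1)).map Prod.snd).sum : ℤ)
          - ((q : ℤ) + 1) * (((hRow q (n - 2)).map Prod.snd).sum : ℤ)
          + 2 * (((hRow q (n - 3)).map Prod.snd).sum : ℤ)) ∧
    hSumA q 1 = 0 ∧ hSumA q 2 = 2 ∧ hSumA q 3 = 6 ∧
    hSumB q 1 = 0 ∧ hSumB q 2 = 0 ∧ hSumB q 3 = 2 * (q - 4) ∧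
    ((hRow q 1).map Prod.snd).sum = 2 ∧ ((hRow q 2).map Prod.snd).sum = 4 ∧
    ((hRow q 3).map Prod.snd).sum = 2 * q := by
  have hA2 : hSumA q 2 = 2 := by simp [hSumA_add_two q 0, hSumA_one, hSumB_one]
  have hB2 : hSumB q 2 = 0 := by simp [hSumB_add_two q 0, hSumA_one, hSumB_one]
  have hA3 : hSumA q 3 = 6 := by simp [hSumA_add_two q 1, hA2, hB2]
  have hB3 : hSumB q 3 = 2 * (q - 4) := by simp [hSumB_add_two q 1, hA2, hB2, mul_comm]
  refine ⟨fun n hn => ?_, fun n hn => ?_, hSumA_one q, hA2, hA3, hSumB_one q, hB2, hB3, ?_, ?_, ?_⟩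
  · obtain ⟨m, rfl⟩ := Nat.exists_eq_add_of_le' hn
    exact sum_hRow_succ q m
  · obtain ⟨m, rfl⟩ := Nat.exists_eq_add_of_le' hn
    have hA (k : ℕ) : (hSumA q (k + 2) : ℤ) = 2 * hSumA q (k + 1) + 2 * hSumB q (k + 1) + 2 := by
      exact_mod_cast hSumA_add_two q k
    have hB (k : ℕ) : (hSumB q (k + 2) : ℤ) =
        ((q : ℤ) - 4) * hSumA q (k + 1) + ((q : ℤ) - 3) * hSumB q (k + 1) := by
      rw [hSumB_add_two]
      push_cast [Nat.cast_sub (show 4 ≤ q by omega), Nat.cast_sub (show 3 ≤ q by omega)]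
      rfl
    simp only [show m + 4 - 1 = m + 3 by omega, show m + 4 - 2 = m + 2 by omega,
      show m + 4 - 3 = m + 1 by omega, sum_hRow_succ]
    push_cast
    rw [hA (m + 2), hB (m + 2), hA (m + 1), hB (m + 1), hA m, hB m]
    refine ⟨?_, ?_, ?_⟩ <;> ring
  · rw [sum_hRow_succ, hSumA_one, hSumB_one]
  · rw [sum_hRow_succ, hA2, hB2]
  · rw [sum_hRow_succ, hA3, hB3]
    omega
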